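/- arXiv:1301.7024 — 3 statements merged into one kernel-verified Lean document; each statement's English description precedes it below -/
import Mathlib

section
/- Let D be a positive non-square discriminant (D ∈ ℕ, D > 0, D not a perfect square, D ≡ 0 or 1 mod 4). For every real number x, the family of positive real numbers (Q(x))_{Q ∈ 𝒬_D⟨x⟩} is summable, and its sum A_D(x) := Σ_{Q ∈ 𝒬_D⟨x⟩} Q(x) is a constant independent of x. -/
open Polynomial Matrix

noncomputable section

abbrev Mat2 := Matrix (Fin 2) (Fin 2) ℤ

/-- The matrix `Tⁿ = [[1,n],[0,1]]`. -/
def Tpow (n : ℤ) : Mat2 := !![1, n; 0, 1]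

/-- The matrix `ε = [[0,1],[1,0]]`. -/
def Meps : Mat2 := !![0, 1; 1, 0]

/-- The matrix `S = [[0,-1],[1,0]]`. -/
def MS : Mat2 := !![0, -1; 1, 0]

/-- The matrix `T = [[1,1],[0,1]]`. -/
def MT : Mat2 := !![1, 1; 0, 1]

/-- The matrix `σ = [[-1,0],[0,1]]`. -/
def Msig : Mat2 := !![-1, 0; 0, 1]

/-- The matrix `U = TS = [[1,-1],[1,0]]`. -/
def MU : Mat2 := MT * MS

/-- Möbius action of an integer matrix on a real number. -/
def moeb (M : Mat2) (x : ℝ) : ℝ :=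
  ((M 0 0 : ℝ) * x + (M 0 1 : ℝ)) / ((M 1 0 : ℝ) * x + (M 1 1 : ℝ))

/-- The sequence `x_i` of the (positive) continued fraction algorithm:
`x_0 = x`, `x_{i+1} = 1/(x_i - ⌊x_i⌋)`. -/
def cfX (x : ℝ) : ℕ → ℝ
  | 0 => x
  | i + 1 => 1 / (cfX x i - (⌊cfX x i⌋ : ℝ))

/-- The partial quotients `n_i = ⌊x_i⌋` of the continued fraction of `x`. -/
def cfN (x : ℝ) (i : ℕ) : ℤ := ⌊cfX x i⌋

/-- The matrices `γ_0 = Id`, `γ_{i+1} = ε T^{-n_i} γ_i`. -/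
def gam (x : ℝ) : ℕ → Mat2
  | 0 => 1
  | i + 1 => (Meps * Tpow (-(cfN x i))) * gam x i

/-- `Γ(x) = {γ_1, γ_2, γ_3, …}`. -/
def GammaSet (x : ℝ) : Set Mat2 := {M | ∃ i, 1 ≤ i ∧ M = gam x i}

/-- The matrices `γ'_0 = Id`, `γ'_{i+1} = Tγ'_i` if `γ'_i(x) ≤ 0`,
`T^{-1}εγ'_i` if `0 < γ'_i(x) ≤ 1`, and `T^{-1}γ'_i` if `γ'_i(x) > 1`. -/
def gam' (x : ℝ) : ℕ → Mat2
  | 0 => 1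
  | i + 1 =>
    if moeb (gam' x i) x ≤ 0 then MT * gam' x i
    else if moeb (gam' x i) x ≤ 1 then (Tpow (-1) * Meps) * gam' x i
    else Tpow (-1) * gam' x i

/-- `Γ(x)' = {γ'_1, γ'_2, γ'_3, …}`. -/
def GammaSet' (x : ℝ) : Set Mat2 := {M | ∃ i, 1 ≤ i ∧ M = gam' x i}

/-- The sequence `x_i` of the negative continued fraction algorithm:
`x_0 = x`, `x_{i+1} = 1/(⌈x_i⌉ - x_i)`. -/
def ncfX (x : ℝ) : ℕ → ℝ
  | 0 => x
  | i + 1 => 1 / ((⌈ncfX x i⌉ : ℝ) - ncfX x i)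

/-- The partial quotients `m_i = ⌈x_i⌉` of the negative continued fraction of `x`. -/
def ncfM (x : ℝ) (i : ℕ) : ℤ := ⌈ncfX x i⌉

/-- The matrices `γ̃_0 = Id`, `γ̃_{i+1} = S T^{-m_i} γ̃_i`. -/
def gamt (x : ℝ) : ℕ → Mat2
  | 0 => 1
  | i + 1 => (MS * Tpow (-(ncfM x i))) * gamt x i

/-- `Γ₁(x) = {γ̃_1, γ̃_2, γ̃_3, …}`. -/
def Gamma1Set (x : ℝ) : Set Mat2 := {M | ∃ i, 1 ≤ i ∧ M = gamt x i}

/-- A binary quadratic polynomial `aX² + bX + c`, encoded as the triple `(a,b,c)`. -/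
abbrev QF := ℤ × ℤ × ℤ

/-- The value of `aX² + bX + c` at a real number `x`. -/
def Qval (q : QF) (x : ℝ) : ℝ := (q.1 : ℝ) * x ^ 2 + (q.2.1 : ℝ) * x + (q.2.2 : ℝ)

/-- The value of `aX² + bX + c` at an integer `m`. -/
def QvalZ (q : QF) (m : ℤ) : ℤ := q.1 * m ^ 2 + q.2.1 * m + q.2.2

/-- The discriminant `b² - 4ac`. -/
def Qdisc (q : QF) : ℤ := q.2.1 ^ 2 - 4 * q.1 * q.2.2

/-- The homogenized value `a r² + b r t + c t²`; for `t ≠ 0` its sign is that of `Q(r/t)`,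
and for `t = 0` that of the leading coefficient, i.e. of `Q(∞)`. -/
def Qhom (q : QF) (r t : ℤ) : ℤ := q.1 * r ^ 2 + q.2.1 * r * t + q.2.2 * t ^ 2

/-- The weight 2 action `(Q|γ)(X) = (tX+u)² Q((rX+s)/(tX+u))` on quadratic polynomials,
for `γ = [[r,s],[t,u]]`. -/
def qslash (M : Mat2) (q : QF) : QF :=
  (Qhom q (M 0 0) (M 1 0),
   2 * q.1 * M 0 0 * M 0 1 + q.2.1 * (M 0 0 * M 1 1 + M 0 1 * M 1 0) + 2 * q.2.2 * M 1 0 * M 1 1,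
   Qhom q (M 0 1) (M 1 1))

/-- The set `𝒬` of integral quadratic polynomials with positive non-square discriminant. -/
def Qset : Set QF := {q | 0 < Qdisc q ∧ ¬ IsSquare (Qdisc q)}

/-- `A` is a `Γ`-equivalence class in `𝒬`, where `Γ = PGL₂(ℤ)`. -/
def IsClassQ (A : Set QF) : Prop :=
  ∃ q₀ ∈ Qset, A = {q ∈ Qset | ∃ M : Mat2, IsUnit M.det ∧ q = qslash M q₀}

/-- `B` is a `Γ₁`-equivalence class in `𝒬`, where `Γ₁ = PSL₂(ℤ)`. -/
def IsClassQ1 (B : Set QF) : Prop :=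
  ∃ q₀ ∈ Qset, B = {q ∈ Qset | ∃ M : Mat2, M.det = 1 ∧ q = qslash M q₀}

/-- `A^Sim = {Q ∈ A : Q(0) < 0 < Q(∞)}`. -/
def QSim (A : Set QF) : Set QF := {q ∈ A | q.2.2 < 0 ∧ 0 < q.1}

/-- `A^Red = {Q ∈ A : Q(∞) > 0, Q(-1) < 0 < Q(0)}`. -/
def QRed (A : Set QF) : Set QF := {q ∈ A | 0 < q.1 ∧ q.1 - q.2.1 + q.2.2 < 0 ∧ 0 < q.2.2}

/-- `A⟨x⟩ = {Q ∈ A : Q(∞) < 0 < Q(x)}`. -/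
def QxSet (A : Set QF) (x : ℝ) : Set QF := {q ∈ A | q.1 < 0 ∧ 0 < Qval q x}

/-- `𝒬_D⟨x⟩`, the set of quadratics of discriminant `D` with `Q(∞) < 0 < Q(x)`. -/
def QDx (D : ℕ) (x : ℝ) : Set QF :=
  {q | Qdisc q = (D : ℤ) ∧ q.1 < 0 ∧ 0 < Qval q x}

/-- The simple forms of discriminant `D`: `a > 0 > c`. -/
def SimpleD (D : ℕ) : Set QF := {q | Qdisc q = (D : ℤ) ∧ 0 < q.1 ∧ q.2.2 < 0}

/-- The reduced forms of discriminant `D`: `a > 0`, `c > 0`, `b > a + c`. -/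
def ReducedD (D : ℕ) : Set QF :=
  {q | Qdisc q = (D : ℤ) ∧ 0 < q.1 ∧ 0 < q.2.2 ∧ q.1 + q.2.2 < q.2.1}

/-- Homogenized evaluation of a polynomial of degree ≤ d: `∑ P_j r^j t^{d-j}`;
for `t ≠ 0` its sign is that of `P(r/t)` (`d` even), and for `t = 0` that of `P(∞)`. -/
def homEval (d : ℕ) (P : Polynomial ℤ) (r t : ℤ) : ℤ :=
  ∑ j ∈ Finset.range (d + 1), P.coeff j * r ^ j * t ^ (d - j)

/-- The weight `d` action `(P|γ)(X) = (tX+u)^d P((rX+s)/(tX+u))` on integral polynomials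
of degree at most `d`, for `γ = [[r,s],[t,u]]`. -/
def pslash (d : ℕ) (M : Mat2) (P : Polynomial ℤ) : Polynomial ℤ :=
  ∑ j ∈ Finset.range (d + 1),
    C (P.coeff j) * (C (M 0 0) * X + C (M 0 1)) ^ j * (C (M 1 0) * X + C (M 1 1)) ^ (d - j)

/-- `P` has exactly two real roots `w ≠ w'`, both irrational. -/
def HasTwoIrratRoots (P : Polynomial ℤ) (w w' : ℝ) : Prop :=
  w ≠ w' ∧ Irrational w ∧ Irrational w' ∧ ∀ y : ℝ, Polynomial.aeval y P = 0 ↔ y = w ∨ y = w'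

/-- `F_d`: integral polynomials of degree ≤ d with exactly two real roots, both irrational. -/
def Fd (d : ℕ) : Set (Polynomial ℤ) :=
  {P | P.natDegree ≤ d ∧ ∃ w w' : ℝ, HasTwoIrratRoots P w w'}

/-- `A` is a `Γ`-equivalence class in `F_d`, where `Γ = PGL₂(ℤ)`. -/
def IsClassF (d : ℕ) (A : Set (Polynomial ℤ)) : Prop :=
  ∃ P₀ ∈ Fd d, A = {P ∈ Fd d | ∃ M : Mat2, IsUnit M.det ∧ P = pslash d M P₀}

/-- `B` is a `Γ₁`-equivalence class in `F_d`, where `Γ₁ = PSL₂(ℤ)`. -/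
def IsClassF1 (d : ℕ) (B : Set (Polynomial ℤ)) : Prop :=
  ∃ P₀ ∈ Fd d, B = {P ∈ Fd d | ∃ M : Mat2, M.det = 1 ∧ P = pslash d M P₀}

/-- `A^Sim = {P ∈ A : P(0) < 0 < P(∞)}`, where `P(∞)` is the coefficient of `X^d`. -/
def PSim (d : ℕ) (A : Set (Polynomial ℤ)) : Set (Polynomial ℤ) :=
  {P ∈ A | P.coeff 0 < 0 ∧ 0 < P.coeff d}

/-- `A^Red = {P ∈ A : P(∞) > 0 and P(-1) < 0 < P(0)}`. -/
def PRed (d : ℕ) (A : Set (Polynomial ℤ)) : Set (Polynomial ℤ) :=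
  {P ∈ A | 0 < P.coeff d ∧ Polynomial.aeval (-1 : ℤ) P < 0 ∧ 0 < P.coeff 0}

/-- `A⟨x⟩ = {P ∈ A : P(∞) < 0 < P(x)}`. -/
def Px (d : ℕ) (A : Set (Polynomial ℤ)) (x : ℝ) : Set (Polynomial ℤ) :=
  {P ∈ A | P.coeff d < 0 ∧ 0 < Polynomial.aeval x P}

/-- The numerators of the convergents, shifted by 2: `pconv x i = p_{i-2}`. -/
def pconv (x : ℝ) : ℕ → ℤ
  | 0 => 0
  | 1 => 1
  | i + 2 => cfN x i * pconv x (i + 1) + pconv x i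

/-- The denominators of the convergents, shifted by 2: `qconv x i = q_{i-2}`. -/
def qconv (x : ℝ) : ℕ → ℤ
  | 0 => 1
  | 1 => 0
  | i + 2 => cfN x i * qconv x (i + 1) + qconv x i

/-- `δ_i = (-1)^i (p_{i-1} - q_{i-1} x)` for `i ≥ 0`. -/
def cfDelta (x : ℝ) (i : ℕ) : ℝ :=
  (-1 : ℝ) ^ i * ((pconv x (i + 1) : ℝ) - (qconv x (i + 1) : ℝ) * x)

/-- The weight `d` action `(P|γ)(X) = (tX+u)^d P((rX+s)/(tX+u))` on complex polynomials
of degree at most `d`, for `γ = [[r,s],[t,u]]` with integer entries. -/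
def cslash (d : ℕ) (M : Mat2) (P : Polynomial ℂ) : Polynomial ℂ :=
  ∑ j ∈ Finset.range (d + 1),
    C (P.coeff j) * (C (M 0 0 : ℂ) * X + C (M 0 1 : ℂ)) ^ j *
      (C (M 1 0 : ℂ) * X + C (M 1 1 : ℂ)) ^ (d - j)

/-- `P^Γ(x) = ∑_{γ ∈ Γ(x)} (P|γ)(x)` for `P` of degree ≤ 2k. -/
def PGam (k : ℕ) (P : Polynomial ℂ) (x : ℝ) : ℂ :=
  ∑' γ : GammaSet x, Polynomial.eval (x : ℂ) (cslash (2 * k) γ.1 P)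

/-- The sum over all forms of discriminant `D` with negative leading coefficient of the positive
part of the value at `x`. -/
def posPartSum (D : ℕ) (x : ℝ) : ENNReal :=
  ∑' q : QF, if Qdisc q = (D : ℤ) ∧ q.1 < 0 then ENNReal.ofReal (Qval q x) else 0

/-- The finitely many forms of discriminant `D` with `a < 0 < c`. -/
def negSimple (D : ℕ) : Finset QF :=
  (Finset.Icc (-D : ℤ) D ×ˢ (Finset.Icc (-D : ℤ) D ×ˢ Finset.Icc (-D : ℤ) D)).filter
    fun q => Qdisc q = (D : ℤ) ∧ q.1 < 0 ∧ 0 < q.2.2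

theorem mem_negSimple {D : ℕ} {q : QF} :
    q ∈ negSimple D ↔ Qdisc q = (D : ℤ) ∧ q.1 < 0 ∧ 0 < q.2.2 := by
  obtain ⟨a, b, c⟩ := q
  simp only [negSimple, Finset.mem_filter, Finset.mem_product, Finset.mem_Icc, and_iff_right_iff_imp]
  rintro ⟨h, ha, hc⟩
  simp only [Qdisc] at h ha hc ⊢
  have hac : 0 < -a * c := mul_pos (by linarith) hc
  refine ⟨⟨?_, ?_⟩, ⟨?_, ?_⟩, ?_, ?_⟩ <;> nlinarith [sq_nonneg b]

/-- The common value of `A_D(x)`. -/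
def negSimpleConst (D : ℕ) : ℝ := ∑ q ∈ negSimple D, (q.2.2 : ℝ)

theorem negSimpleConst_nonneg (D : ℕ) : 0 ≤ negSimpleConst D :=
  Finset.sum_nonneg fun q hq => by exact_mod_cast (mem_negSimple.1 hq).2.2.le

theorem sum_negSimple_fst (D : ℕ) :
    ∑ q ∈ negSimple D, (q.1 : ℝ) = -negSimpleConst D := by
  rw [negSimpleConst, ← Finset.sum_neg_distrib]
  refine Finset.sum_nbij' (fun q => (-q.2.2, q.2.1, -q.1)) (fun q => (-q.2.2, q.2.1, -q.1))
    ?_ ?_ ?_ ?_ ?_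
  · intro q hq
    simp only [mem_negSimple, Qdisc] at hq ⊢
    exact ⟨by linarith, by linarith, by linarith⟩
  · intro q hq
    simp only [mem_negSimple, Qdisc] at hq ⊢
    exact ⟨by linarith, by linarith, by linarith⟩
  all_goals simp

theorem sum_negSimple_snd (D : ℕ) : ∑ q ∈ negSimple D, (q.2.1 : ℝ) = 0 := by
  have h : ∑ q ∈ negSimple D, (q.2.1 : ℝ) = ∑ q ∈ negSimple D, -(q.2.1 : ℝ) := by
    refine Finset.sum_nbij' (fun q => (q.1, -q.2.1, q.2.2)) (fun q => (q.1, -q.2.1, q.2.2))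
      ?_ ?_ ?_ ?_ ?_
    · intro q hq
      simpa [mem_negSimple, Qdisc] using hq
    · intro q hq
      simpa [mem_negSimple, Qdisc] using hq
    all_goals simp
  rw [Finset.sum_neg_distrib] at h
  linarith

theorem sum_negSimple_Qval (D : ℕ) (x : ℝ) :
    ∑ q ∈ negSimple D, Qval q x = negSimpleConst D * (1 - x ^ 2) := by
  simp only [Qval, Finset.sum_add_distrib, ← Finset.sum_mul, sum_negSimple_fst,
    sum_negSimple_snd]
  rw [← negSimpleConst]
  ring

theorem fst_ne_zero_of_Qdisc_eq {D : ℕ} (hns : ¬ IsSquare D) {q : QF}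
    (h : Qdisc q = (D : ℤ)) : q.1 ≠ 0 := by
  intro h0
  refine hns ⟨q.2.1.natAbs, ?_⟩
  simp only [Qdisc, h0] at h
  zify
  rw [abs_mul_abs_self]
  linarith

theorem trd_ne_zero_of_Qdisc_eq {D : ℕ} (hns : ¬ IsSquare D) {q : QF}
    (h : Qdisc q = (D : ℤ)) : q.2.2 ≠ 0 :=
  fst_ne_zero_of_Qdisc_eq (q := (q.2.2, q.2.1, q.1)) hns (by simp only [Qdisc] at h ⊢; linarith)

/-- The substitution `X ↦ X + 1` on quadratic polynomials. -/
def shiftEquiv : QF ≃ QF where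
  toFun q := (q.1, 2 * q.1 + q.2.1, q.1 + q.2.1 + q.2.2)
  invFun q := (q.1, q.2.1 - 2 * q.1, q.2.2 - q.2.1 + q.1)
  left_inv q := by ext <;> (simp; try ring)
  right_inv q := by ext <;> (simp; try ring)

/-- Exchanging the outer coefficients of a quadratic polynomial. -/
def reverseEquiv : QF ≃ QF where
  toFun q := (q.2.2, q.2.1, q.1)
  invFun q := (q.2.2, q.2.1, q.1)
  left_inv _ := rfl
  right_inv _ := rfl

theorem posPartSum_add_one (D : ℕ) (x : ℝ) : posPartSum D (x + 1) = posPartSum D x := by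
  symm
  rw [posPartSum, posPartSum, ← shiftEquiv.tsum_eq]
  refine tsum_congr fun q => ?_
  have h1 : Qdisc (shiftEquiv q) = Qdisc q := by simp only [Qdisc, shiftEquiv, Equiv.coe_fn_mk]; ring
  have h2 : Qval (shiftEquiv q) x = Qval q (x + 1) := by
    simp only [Qval, shiftEquiv, Equiv.coe_fn_mk]; push_cast; ring
  rw [h1, h2]
  rfl

theorem posPartSum_fract (D : ℕ) (x : ℝ) : posPartSum D (Int.fract x) = posPartSum D x := by
  have h : Function.Periodic (posPartSum D) 1 := posPartSum_add_one D
  have h' := h.sub_int_mul_eq (x := x) ⌊x⌋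
  rwa [mul_one] at h'

theorem posPartSum_zero {D : ℕ} : posPartSum D 0 = ENNReal.ofReal (negSimpleConst D) := by
  rw [posPartSum, tsum_eq_sum (s := negSimple D), negSimpleConst, ENNReal.ofReal_sum_of_nonneg]
  · refine Finset.sum_congr rfl fun q hq => ?_
    have := mem_negSimple.1 hq
    simp [this.1, this.2.1, Qval]
  · exact fun q hq => by exact_mod_cast (mem_negSimple.1 hq).2.2.le
  · intro q hq
    rw [mem_negSimple] at hq
    split_ifs with h
    · simp only [Qval, ENNReal.ofReal_eq_zero]
      have : q.2.2 ≤ 0 := by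
        by_contra hc
        exact hq ⟨h.1, h.2, not_le.1 hc⟩
      have : (q.2.2 : ℝ) ≤ 0 := by exact_mod_cast this
      simpa
    · rfl

/-- The transformation law under `x ↦ x⁻¹`: both sides sum the positive parts of the values at `x`
of all forms with `a < 0` or `c < 0`. -/
theorem posPartSum_add_eq {D : ℕ} (hns : ¬ IsSquare D) {x : ℝ} (hx : x ≠ 0) :
    posPartSum D x + ∑ q ∈ negSimple D, ENNReal.ofReal (-Qval q x) =
      ENNReal.ofReal (x ^ 2) * posPartSum D x⁻¹ +
        ∑ q ∈ negSimple D, ENNReal.ofReal (Qval q x) := by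
  have hrev : ENNReal.ofReal (x ^ 2) * posPartSum D x⁻¹ =
      ∑' q : QF, if Qdisc q = (D : ℤ) ∧ q.2.2 < 0 then ENNReal.ofReal (Qval q x) else 0 := by
    rw [posPartSum, ← ENNReal.tsum_mul_left, ← reverseEquiv.tsum_eq]
    refine tsum_congr fun q => ?_
    have h1 : Qdisc (reverseEquiv q) = Qdisc q := by
      simp only [Qdisc, reverseEquiv, Equiv.coe_fn_mk]; ring
    have h2 : x ^ 2 * Qval (reverseEquiv q) x⁻¹ = Qval q x := by
      simp only [Qval, reverseEquiv, Equiv.coe_fn_mk]; field_simp; ring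
    rw [h1, mul_ite, mul_zero, ← ENNReal.ofReal_mul (sq_nonneg x), h2]
    rfl
  have hpos : ∑ q ∈ negSimple D, ENNReal.ofReal (Qval q x) =
      ∑' q : QF, if Qdisc q = (D : ℤ) ∧ q.1 < 0 ∧ 0 < q.2.2
        then ENNReal.ofReal (Qval q x) else 0 := by
    rw [tsum_eq_sum (s := negSimple D)]
    · exact Finset.sum_congr rfl fun q hq => (if_pos (mem_negSimple.1 hq)).symm
    · exact fun q hq => if_neg (mt mem_negSimple.2 hq)
  have hneg : ∑ q ∈ negSimple D, ENNReal.ofReal (-Qval q x) =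
      ∑' q : QF, if Qdisc q = (D : ℤ) ∧ 0 < q.1 ∧ q.2.2 < 0
        then ENNReal.ofReal (Qval q x) else 0 := by
    rw [← (Equiv.neg QF).tsum_eq, tsum_eq_sum (s := negSimple D)]
    · refine Finset.sum_congr rfl fun q hq => ?_
      have hq := mem_negSimple.1 hq
      rw [if_pos]
      · congr 1
        simp only [Qval, Equiv.neg_apply, Prod.fst_neg, Prod.snd_neg]; push_cast; ring
      · simpa [Qdisc] using hq
    · intro q hq
      refine if_neg fun h => hq (mem_negSimple.2 ?_)
      simpa [Qdisc] using h
  rw [hrev, hpos, hneg, posPartSum, ← ENNReal.tsum_add, ← ENNReal.tsum_add]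
  refine tsum_congr fun q => ?_
  by_cases h : Qdisc q = (D : ℤ)
  · have ha := fst_ne_zero_of_Qdisc_eq hns h
    have hc := trd_ne_zero_of_Qdisc_eq hns h
    rcases ha.lt_or_gt with ha | ha <;> rcases hc.lt_or_gt with hc | hc <;>
      simp [h, ha, hc, ha.not_gt, hc.not_gt]
  · simp [h]

theorem posPartSum_ne_top_of_inv {D : ℕ} (hns : ¬ IsSquare D) {x : ℝ} (hx : x ≠ 0)
    (h : posPartSum D x⁻¹ ≠ ⊤) : posPartSum D x ≠ ⊤ := by
  refine ne_top_of_le_ne_top ?_ (le_self_add.trans_eq (posPartSum_add_eq hns hx))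
  exact ENNReal.add_ne_top.2 ⟨ENNReal.mul_ne_top ENNReal.ofReal_ne_top h,
    ENNReal.sum_ne_top.2 fun _ _ => ENNReal.ofReal_ne_top⟩

theorem toReal_posPartSum_eq {D : ℕ} (hns : ¬ IsSquare D) {x : ℝ} (hx : x ≠ 0)
    (h : posPartSum D x⁻¹ ≠ ⊤) :
    (posPartSum D x).toReal - negSimpleConst D =
      x ^ 2 * ((posPartSum D x⁻¹).toReal - negSimpleConst D) := by
  have key := congrArg ENNReal.toReal (posPartSum_add_eq (D := D) hns hx)
  have hfin : ∀ f : QF → ℝ, ∑ q ∈ negSimple D, ENNReal.ofReal (f q) ≠ ⊤ := fun f =>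
    ENNReal.sum_ne_top.2 fun _ _ => ENNReal.ofReal_ne_top
  rw [ENNReal.toReal_add (posPartSum_ne_top_of_inv hns hx h) (hfin _),
    ENNReal.toReal_add (ENNReal.mul_ne_top ENNReal.ofReal_ne_top h) (hfin _),
    ENNReal.toReal_mul, ENNReal.toReal_ofReal (sq_nonneg x),
    ENNReal.toReal_sum fun _ _ => ENNReal.ofReal_ne_top,
    ENNReal.toReal_sum fun _ _ => ENNReal.ofReal_ne_top] at key
  have hsub : ∑ q ∈ negSimple D, (ENNReal.ofReal (Qval q x)).toReal -
      ∑ q ∈ negSimple D, (ENNReal.ofReal (-Qval q x)).toReal =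
        negSimpleConst D * (1 - x ^ 2) := by
    rw [← Finset.sum_sub_distrib, ← sum_negSimple_Qval]
    refine Finset.sum_congr rfl fun q _ => ?_
    rw [ENNReal.toReal_ofReal', ENNReal.toReal_ofReal']
    exact posPart_sub_negPart _
  linarith

theorem posPartSum_natCast_div {D : ℕ} (hns : ¬ IsSquare D) (n : ℕ) :
    ∀ m : ℕ, 0 < m → posPartSum D (n / m : ℝ) = ENNReal.ofReal (negSimpleConst D) := by
  induction n using Nat.strong_induction_on with
  | _ n ih =>
    intro m hm
    rcases Nat.eq_zero_or_pos n with rfl | hn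
    · simp [posPartSum_zero]
    have hx : (n / m : ℝ) ≠ 0 := by positivity
    have hinv : posPartSum D (n / m : ℝ)⁻¹ = ENNReal.ofReal (negSimpleConst D) := by
      have hlt : m % n < n := Nat.mod_lt _ hn
      rw [inv_div, ← posPartSum_fract, Int.fract_div_natCast_eq_div_natCast_mod]
      exact ih _ hlt n hn
    have hne : posPartSum D (n / m : ℝ)⁻¹ ≠ ⊤ := hinv ▸ ENNReal.ofReal_ne_top
    have h := toReal_posPartSum_eq hns hx hne
    rw [hinv, ENNReal.toReal_ofReal (negSimpleConst_nonneg D), sub_self, mul_zero, sub_eq_zero] at h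
    rw [← h, ENNReal.ofReal_toReal (posPartSum_ne_top_of_inv hns hx hne)]

theorem posPartSum_ratCast {D : ℕ} (hns : ¬ IsSquare D) (r : ℚ) :
    posPartSum D r = ENNReal.ofReal (negSimpleConst D) := by
  have h : (0 : ℚ) ≤ Int.fract r := Int.fract_nonneg r
  have hr : ((Int.fract r : ℚ) : ℝ) = ((Int.fract r).num.toNat : ℝ) / ((Int.fract r).den : ℝ) := by
    have h2 : (((Int.fract r).num.toNat : ℤ) : ℝ) = ((Int.fract r).num : ℝ) := by
      rw [Int.toNat_of_nonneg (Rat.num_nonneg.2 h)]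
    rw [Rat.cast_def, ← h2, Int.cast_natCast]
  rw [← posPartSum_fract, ← Rat.cast_fract, hr]
  exact posPartSum_natCast_div hns _ _ (Rat.den_pos _)

theorem posPartSum_le {D : ℕ} (hns : ¬ IsSquare D) (x : ℝ) :
    posPartSum D x ≤ ENNReal.ofReal (negSimpleConst D) := by
  rw [posPartSum, ENNReal.tsum_eq_iSup_sum]
  refine iSup_le fun s => ?_
  refine Rat.denseRange_cast.induction_on x ?_ fun r => ?_
  · refine isClosed_le (continuous_finsetSum _ fun q _ => ?_) continuous_const
    split_ifs
    · exact ENNReal.continuous_ofReal.comp (by unfold Qval; fun_prop)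
    · exact continuous_const
  · exact (ENNReal.sum_le_tsum s).trans_eq (posPartSum_ratCast hns r)

theorem mul_fract_inv_le_half {x : ℝ} (h0 : 0 < x) (h1 : x < 1) : x * Int.fract x⁻¹ ≤ 1 / 2 := by
  have hf : (1 : ℝ) ≤ ⌊x⁻¹⌋ := by
    exact_mod_cast Int.le_floor.2 (by simpa using ((one_lt_inv₀ h0).2 h1).le)
  have hfr := Int.fract_lt_one x⁻¹
  have hsum := Int.floor_add_fract x⁻¹
  have hxx : x * x⁻¹ = 1 := mul_inv_cancel₀ h0.ne'
  have : x * ⌊x⁻¹⌋ + x * Int.fract x⁻¹ = 1 := by rw [← mul_add, hsum, hxx]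
  have : x * Int.fract x⁻¹ ≤ x * ⌊x⁻¹⌋ := mul_le_mul_of_nonneg_left (by linarith) h0.le
  linarith

theorem posPartSum_eq {D : ℕ} (hns : ¬ IsSquare D) (x : ℝ) :
    posPartSum D x = ENNReal.ofReal (negSimpleConst D) := by
  have hfin : ∀ y, posPartSum D y ≠ ⊤ := fun y =>
    ne_top_of_le_ne_top ENNReal.ofReal_ne_top (posPartSum_le hns y)
  set g : ℝ → ℝ := fun y => (posPartSum D y).toReal - negSimpleConst D with hg
  have hfr : ∀ y, g (Int.fract y) = g y := fun y => by simp only [hg, posPartSum_fract]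
  have hinv : ∀ y, y ≠ 0 → g y = y ^ 2 * g y⁻¹ := fun y hy =>
    toReal_posPartSum_eq hns hy (hfin _)
  have hzero : g 0 = 0 := by
    simp [hg, posPartSum_zero, ENNReal.toReal_ofReal (negSimpleConst_nonneg D)]
  have hstep : ∀ M : ℝ, 0 ≤ M → (∀ y, |g y| ≤ M) → ∀ y, |g y| ≤ M / 4 := by
    intro M hM hb y
    rw [← hfr y]
    rcases (Int.fract_nonneg y).eq_or_lt with h | h
    · rw [← h, hzero, abs_zero]; positivity
    set u := Int.fract y
    have hu : |g u| = u ^ 2 * |g (Int.fract u⁻¹)| := by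
      rw [hinv u h.ne', hfr, abs_mul, abs_of_nonneg (sq_nonneg u)]
    rcases (Int.fract_nonneg u⁻¹).eq_or_lt with h' | h'
    · rw [hu, ← h', hzero, abs_zero, mul_zero]; positivity
    have hhalf := mul_fract_inv_le_half h (Int.fract_lt_one y)
    set v := Int.fract u⁻¹
    rw [hu, hinv v h'.ne', abs_mul, abs_of_nonneg (sq_nonneg v), ← mul_assoc, ← mul_pow]
    calc (u * v) ^ 2 * |g v⁻¹| ≤ (1 / 2) ^ 2 * M := by
          gcongr
          exact hb _
      _ = M / 4 := by ring
  have hbound : ∀ y, |g y| ≤ negSimpleConst D := fun y => by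
    have h1 : (posPartSum D y).toReal ≤ negSimpleConst D :=
      ENNReal.toReal_le_of_le_ofReal (negSimpleConst_nonneg D) (posPartSum_le hns y)
    have h2 : 0 ≤ (posPartSum D y).toReal := ENNReal.toReal_nonneg
    rw [abs_le]
    constructor <;> simp only [hg] <;> linarith
  have hpow : ∀ n : ℕ, ∀ y, |g y| ≤ negSimpleConst D * (1 / 4) ^ n := by
    intro n
    induction n with
    | zero => simpa using hbound
    | succ n ih =>
      intro y
      refine (hstep _ (mul_nonneg (negSimpleConst_nonneg D) (by positivity)) ih y).trans_eq ?_
      ring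
  have hlim : Filter.Tendsto (fun n : ℕ => negSimpleConst D * (1 / 4 : ℝ) ^ n) Filter.atTop
      (nhds 0) := by
    simpa using (tendsto_pow_atTop_nhds_zero_of_lt_one (by norm_num : (0 : ℝ) ≤ 1 / 4)
      (by norm_num)).const_mul (negSimpleConst D)
  have hgx : g x = 0 := abs_nonpos_iff.1 (ge_of_tendsto' hlim fun n => hpow n x)
  rw [← ENNReal.ofReal_toReal (hfin x), sub_eq_zero.1 hgx]

theorem posPartSum_eq_tsum_QDx (D : ℕ) (x : ℝ) :
    posPartSum D x = ∑' q : ↥(QDx D x), ENNReal.ofReal (Qval q.1 x) := by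
  rw [tsum_subtype (QDx D x) fun q => ENNReal.ofReal (Qval q x), posPartSum]
  refine tsum_congr fun q => ?_
  simp only [Set.indicator_apply, QDx, Set.mem_ofPred_eq, ← and_assoc]
  by_cases h : Qdisc q = (D : ℤ) ∧ q.1 < 0 <;> by_cases h' : 0 < Qval q x <;> simp [h, h']
  exact not_lt.1 h'

/-- For a positive non-square discriminant `D`, the family
`(Q(x))_{Q ∈ 𝒬_D⟨x⟩}` is summable for every real `x`, and its sum is a constant
independent of `x`. -/
theorem stmt0 (D : ℕ) (hD : 0 < D) (hns : ¬ IsSquare D)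
    (hmod : D % 4 = 0 ∨ D % 4 = 1) :
    ∃ α : ℝ, ∀ x : ℝ,
      Summable (fun q : ↥(QDx D x) => Qval q.1 x) ∧
      (∑' q : ↥(QDx D x), Qval q.1 x) = α := by
  refine ⟨negSimpleConst D, fun x => ?_⟩
  have hnn : ∀ q : ↥(QDx D x), 0 ≤ Qval q.1 x := fun q => q.2.2.2.le
  have htsum : ∑' q : ↥(QDx D x), ENNReal.ofReal (Qval q.1 x) =
      ENNReal.ofReal (negSimpleConst D) :=
    (posPartSum_eq_tsum_QDx D x).symm.trans (posPartSum_eq hns x)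
  have hsum : Summable fun q : ↥(QDx D x) => Qval q.1 x := by
    have h := ENNReal.summable_toReal (htsum ▸ ENNReal.ofReal_ne_top)
    simpa only [ENNReal.toReal_ofReal (hnn _)] using h
  refine ⟨hsum, ?_⟩
  rw [← ENNReal.ofReal_tsum_of_nonneg hnn hsum] at htsum
  exact (ENNReal.ofReal_eq_ofReal_iff (tsum_nonneg hnn) (negSimpleConst_nonneg D)).1 htsum
end
end

section
/- Let D be a positive non-square discriminant. The set {(a,b,c) ∈ ℤ³ : b² − 4ac = D, a > 0 > c} is finite, and for every real number x, Σ_{Q ∈ 𝒬_D⟨x⟩} Q(x) = Σ_{(a,b,c) ∈ ℤ³, b²−4ac=D, a>0>c} a. In particular the sum A_D(x) is constant in x and equals the sum of the leading coefficients of all simple forms of discriminant D. -/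
open Polynomial Matrix

noncomputable section

namespace QF

/-- The translated form `Q(X + n)`. -/
def shift (n : ℤ) : QF ≃ QF where
  toFun q := (q.1, 2 * q.1 * n + q.2.1, q.1 * n ^ 2 + q.2.1 * n + q.2.2)
  invFun q := (q.1, 2 * q.1 * (-n) + q.2.1, q.1 * n ^ 2 - q.2.1 * n + q.2.2)
  left_inv q := by ext <;> simp <;> ring
  right_inv q := by ext <;> simp <;> ring

/-- The reversed form `X² Q(1/X)`. -/
def reverse : QF ≃ QF where
  toFun q := (q.2.2, q.2.1, q.1)
  invFun q := (q.2.2, q.2.1, q.1)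
  left_inv _ := rfl
  right_inv _ := rfl

theorem Qdisc_shift (n : ℤ) (q : QF) : Qdisc (shift n q) = Qdisc q := by
  simp only [Qdisc, shift, Equiv.coe_fn_mk]; ring

theorem Qval_shift (n : ℤ) (q : QF) (x : ℝ) : Qval (shift n q) x = Qval q (x + n) := by
  simp only [Qval, shift, Equiv.coe_fn_mk]; push_cast; ring

theorem Qdisc_reverse (q : QF) : Qdisc (reverse q) = Qdisc q := by
  simp only [Qdisc, reverse, Equiv.coe_fn_mk]; ring

theorem Qval_reverse (q : QF) {x : ℝ} (hx : x ≠ 0) :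
    Qval (reverse q) x = x ^ 2 * Qval q x⁻¹ := by
  simp only [Qval, reverse, Equiv.coe_fn_mk]; field_simp; ring

theorem Qdisc_neg (q : QF) : Qdisc (-q) = Qdisc q := by
  simp only [Qdisc, Prod.fst_neg, Prod.snd_neg]; ring

theorem Qval_neg (q : QF) (x : ℝ) : Qval (-q) x = -Qval q x := by
  simp only [Qval, Prod.fst_neg, Prod.snd_neg]; push_cast; ring

theorem continuous_Qval (q : QF) : Continuous (Qval q) := by
  unfold Qval; fun_prop

end QF

open scoped ENNReal

theorem SimpleD_finite (D : ℕ) : (SimpleD D).Finite := by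
  refine ((Set.finite_Icc (0 : ℤ) D).prod ((Set.finite_Icc (-D : ℤ) D).prod
    (Set.finite_Icc (-D : ℤ) 0))).subset ?_
  rintro ⟨a, b, c⟩ ⟨h, ha, hc⟩
  simp only [Qdisc] at h ha hc
  simp only [Set.mem_prod, Set.mem_Icc]
  have hac : 0 < a * -c := mul_pos ha (by linarith)
  refine ⟨⟨ha.le, ?_⟩, ⟨?_, ?_⟩, ?_, hc.le⟩ <;> nlinarith [sq_nonneg b]

theorem sum_SimpleD_comp (D : ℕ) (f : QF → QF) (hf : Function.Involutive f)
    (hmem : ∀ q ∈ SimpleD D, f q ∈ SimpleD D) (g : QF → ℝ) :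
    ∑ q ∈ (SimpleD_finite D).toFinset, g (f q) = ∑ q ∈ (SimpleD_finite D).toFinset, g q :=
  Finset.sum_nbij' f f (by simpa using hmem) (by simpa using hmem)
    (fun q _ => hf q) (fun q _ => hf q) (fun _ _ => rfl)

/-- The sum of the leading coefficients of the simple forms of discriminant `D`. -/
def leadSum (D : ℕ) : ℝ := ∑ q ∈ (SimpleD_finite D).toFinset, (q.1 : ℝ)

theorem leadSum_nonneg (D : ℕ) : 0 ≤ leadSum D :=
  Finset.sum_nonneg fun q hq => by
    have : 0 < q.1 := ((SimpleD_finite D).mem_toFinset.1 hq).2.1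
    exact_mod_cast this.le

theorem sum_SimpleD_neg_const (D : ℕ) :
    ∑ q ∈ (SimpleD_finite D).toFinset, (-q.2.2 : ℝ) = leadSum D := by
  rw [leadSum, ← sum_SimpleD_comp D (fun q => (-q.2.2, q.2.1, -q.1)) (fun q => by simp)
    (fun q ⟨h, ha, hc⟩ => ⟨by rw [← h]; simp only [Qdisc]; ring, by simpa using hc,
      by simpa using ha⟩)]
  simp

theorem sum_SimpleD_middle (D : ℕ) :
    ∑ q ∈ (SimpleD_finite D).toFinset, (q.2.1 : ℝ) = 0 := by
  have h := sum_SimpleD_comp D (fun q => (q.1, -q.2.1, q.2.2)) (fun q => by simp)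
    (fun q ⟨h, ha, hc⟩ => ⟨by rw [← h]; simp only [Qdisc]; ring, ha, hc⟩) (fun q => (q.2.1 : ℝ))
  simp only [Int.cast_neg, Finset.sum_neg_distrib] at h
  linarith

theorem sum_SimpleD_Qval (D : ℕ) (x : ℝ) :
    ∑ q ∈ (SimpleD_finite D).toFinset, Qval q x = leadSum D * x ^ 2 - leadSum D := by
  have h := sum_SimpleD_neg_const D
  rw [Finset.sum_neg_distrib] at h
  simp only [Qval, Finset.sum_add_distrib, ← Finset.sum_mul, sum_SimpleD_middle]
  rw [← leadSum]
  linarith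

/-- The sum of `max (Q x) 0` over the forms `Q` of discriminant `D` satisfying `p`. -/
def posSum (D : ℕ) (p : QF → Prop) (x : ℝ) : ℝ≥0∞ :=
  ∑' q, {q | Qdisc q = D ∧ p q}.indicator (fun q => ENNReal.ofReal (Qval q x)) q

theorem posSum_congr {D : ℕ} {p p' : QF → Prop} (h : ∀ q, Qdisc q = D → (p q ↔ p' q)) (x : ℝ) :
    posSum D p x = posSum D p' x := by
  have : {q | Qdisc q = D ∧ p q} = {q | Qdisc q = D ∧ p' q} :=
    Set.ext fun q => and_congr_right (h q)
  rw [posSum, this, posSum]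

theorem posSum_or (D : ℕ) {p p' : QF → Prop} (h : ∀ q, p q → ¬ p' q) (x : ℝ) :
    posSum D (fun q => p q ∨ p' q) x = posSum D p x + posSum D p' x := by
  classical
  rw [posSum, posSum, posSum, ← ENNReal.tsum_add]
  refine tsum_congr fun q => ?_
  have := h q
  simp only [Set.indicator_apply, Set.mem_ofPred_eq]
  by_cases h1 : Qdisc q = D <;> by_cases h2 : p q <;> by_cases h3 : p' q <;> simp_all

theorem lowerSemicontinuous_posSum (D : ℕ) (p : QF → Prop) :
    LowerSemicontinuous (posSum D p) := by
  classical
  refine lowerSemicontinuous_tsum fun q => Continuous.lowerSemicontinuous ?_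
  by_cases h : q ∈ {q | Qdisc q = D ∧ p q}
  · simpa only [Set.indicator_of_mem h, Function.comp_def] using
      ENNReal.continuous_ofReal.comp (QF.continuous_Qval q)
  · simpa only [Set.indicator_of_notMem h] using continuous_const

theorem posSum_add_int (D : ℕ) (x : ℝ) (n : ℤ) :
    posSum D (fun q => q.1 < 0) (x + n) = posSum D (fun q => q.1 < 0) x := by
  classical
  rw [posSum, posSum]
  conv_rhs => rw [← (QF.shift n).tsum_eq]
  refine tsum_congr fun q => ?_
  simp only [Set.indicator_apply, Set.mem_ofPred_eq, QF.Qdisc_shift, QF.Qval_shift]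
  rfl

theorem sq_mul_posSum_inv (D : ℕ) {x : ℝ} (hx : x ≠ 0) :
    ENNReal.ofReal (x ^ 2) * posSum D (fun q => q.1 < 0) x⁻¹ =
      posSum D (fun q => q.2.2 < 0) x := by
  classical
  rw [posSum, posSum, ← ENNReal.tsum_mul_left]
  conv_rhs => rw [← QF.reverse.tsum_eq]
  refine tsum_congr fun q => ?_
  simp only [Set.indicator_apply, Set.mem_ofPred_eq, QF.Qdisc_reverse, QF.Qval_reverse q hx,
    mul_ite, mul_zero, ENNReal.ofReal_mul (sq_nonneg x)]
  rfl

theorem posSum_simple (D : ℕ) (x : ℝ) :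
    posSum D (fun q => 0 < q.1 ∧ q.2.2 < 0) x =
      ENNReal.ofReal (∑ q ∈ (SimpleD_finite D).toFinset, max (Qval q x) 0) := by
  classical
  rw [ENNReal.ofReal_sum_of_nonneg fun _ _ => le_max_right _ _]
  change ∑' q, (SimpleD D).indicator _ q = _
  rw [tsum_eq_sum (s := (SimpleD_finite D).toFinset)
    fun q hq => Set.indicator_of_notMem (by simpa using hq) _]
  refine Finset.sum_congr rfl fun q hq => ?_
  rw [Set.indicator_of_mem (by simpa using hq), ENNReal.ofReal_max, ENNReal.ofReal_zero,
    max_eq_left zero_le]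

theorem posSum_neg_simple (D : ℕ) (x : ℝ) :
    posSum D (fun q => q.1 < 0 ∧ 0 < q.2.2) x =
      ENNReal.ofReal (∑ q ∈ (SimpleD_finite D).toFinset, max (-Qval q x) 0) := by
  classical
  rw [ENNReal.ofReal_sum_of_nonneg fun _ _ => le_max_right _ _, posSum, ← (Equiv.neg QF).tsum_eq]
  rw [tsum_eq_sum (s := (SimpleD_finite D).toFinset) fun q hq => Set.indicator_of_notMem (by
    simpa [SimpleD, QF.Qdisc_neg] using hq) _]
  refine Finset.sum_congr rfl fun q hq => ?_
  rw [Set.indicator_of_mem (by simpa [SimpleD, QF.Qdisc_neg] using hq), Equiv.neg_apply,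
    QF.Qval_neg]
  rw [ENNReal.ofReal_max, ENNReal.ofReal_zero, max_eq_left zero_le]

theorem posSum_neg_simple_add (D : ℕ) (x : ℝ) :
    posSum D (fun q => q.1 < 0 ∧ 0 < q.2.2) x + ENNReal.ofReal (x ^ 2) * ENNReal.ofReal (leadSum D)
      = posSum D (fun q => 0 < q.1 ∧ q.2.2 < 0) x + ENNReal.ofReal (leadSum D) := by
  have hA := leadSum_nonneg D
  rw [posSum_simple, posSum_neg_simple, ← ENNReal.ofReal_mul (sq_nonneg x),
    ← ENNReal.ofReal_add (Finset.sum_nonneg fun _ _ => le_max_right _ _) (by positivity),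
    ← ENNReal.ofReal_add (Finset.sum_nonneg fun _ _ => le_max_right _ _) hA]
  congr 1
  have h : ∑ q ∈ (SimpleD_finite D).toFinset, (max (Qval q x) 0 - max (-Qval q x) 0) =
      leadSum D * x ^ 2 - leadSum D := by
    rw [← sum_SimpleD_Qval]
    refine Finset.sum_congr rfl fun q _ => ?_
    rcases le_total 0 (Qval q x) with h | h <;> simp [h]
  rw [Finset.sum_sub_distrib] at h
  linarith

theorem ne_zero_of_Qdisc_eq {D : ℕ} (hns : ¬ IsSquare D) {q : QF} (h : Qdisc q = D) :
    q.1 ≠ 0 ∧ q.2.2 ≠ 0 := by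
  have hsq : q.2.1 ^ 2 ≠ D := fun hb => hns ⟨q.2.1.natAbs, by zify; rw [← sq, sq_abs, hb]⟩
  constructor <;> exact fun h0 => hsq (by rw [← h, Qdisc, h0]; ring)

theorem posSum_lead_neg {D : ℕ} (hns : ¬ IsSquare D) (x : ℝ) :
    posSum D (fun q => q.1 < 0) x = posSum D (fun q => q.1 < 0 ∧ q.2.2 < 0) x +
      posSum D (fun q => q.1 < 0 ∧ 0 < q.2.2) x := by
  rw [← posSum_or D (fun q h h' => by omega)]
  refine posSum_congr (fun q hq => ?_) x
  have := (ne_zero_of_Qdisc_eq hns hq).2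
  omega

theorem posSum_const_neg {D : ℕ} (hns : ¬ IsSquare D) (x : ℝ) :
    posSum D (fun q => q.2.2 < 0) x = posSum D (fun q => q.1 < 0 ∧ q.2.2 < 0) x +
      posSum D (fun q => 0 < q.1 ∧ q.2.2 < 0) x := by
  rw [← posSum_or D (fun q h h' => by omega)]
  refine posSum_congr (fun q hq => ?_) x
  have := (ne_zero_of_Qdisc_eq hns hq).1
  omega

/-- The functional equation of `A_D` under inversion. -/
theorem posSum_inversion {D : ℕ} (hns : ¬ IsSquare D) {x : ℝ} (hx : x ≠ 0) :
    posSum D (fun q => q.1 < 0) x + ENNReal.ofReal (x ^ 2) * ENNReal.ofReal (leadSum D) =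
      ENNReal.ofReal (x ^ 2) * posSum D (fun q => q.1 < 0) x⁻¹ + ENNReal.ofReal (leadSum D) := by
  rw [sq_mul_posSum_inv D hx, posSum_lead_neg hns, posSum_const_neg hns, add_assoc, add_assoc,
    posSum_neg_simple_add]

theorem posSum_zero {D : ℕ} (hns : ¬ IsSquare D) :
    posSum D (fun q => q.1 < 0) 0 = ENNReal.ofReal (leadSum D) := by
  classical
  have h0 : posSum D (fun q => q.1 < 0 ∧ q.2.2 < 0) 0 = 0 := by
    refine ENNReal.tsum_eq_zero.2 fun q => ?_
    rw [Set.indicator_apply_eq_zero]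
    rintro ⟨-, -, hc⟩
    have : (q.2.2 : ℝ) < 0 := by exact_mod_cast hc
    simpa [Qval] using this.le
  rw [posSum_lead_neg hns, h0, zero_add, posSum_neg_simple, ← sum_SimpleD_neg_const]
  congr 1
  refine Finset.sum_congr rfl fun q hq => ?_
  have hc : q.2.2 < 0 := ((SimpleD_finite D).mem_toFinset.1 hq).2.2
  have : (q.2.2 : ℝ) < 0 := by exact_mod_cast hc
  simpa [Qval] using this.le

theorem posSum_rat {D : ℕ} (hns : ¬ IsSquare D) (r : ℚ) :
    posSum D (fun q => q.1 < 0) r = ENNReal.ofReal (leadSum D) := by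
  induction hn : r.den using Nat.strong_induction_on generalizing r with
  | _ n ih =>
    have hr : (r : ℝ) = (Int.fract r : ℚ) + (⌊r⌋ : ℤ) := by
      rw [← Rat.cast_intCast, ← Rat.cast_add, Int.fract_add_floor]
    rw [hr, posSum_add_int]
    rcases eq_or_ne (Int.fract r) 0 with h0 | h0
    · rw [h0, Rat.cast_zero, posSum_zero hns]
    · have hinv := posSum_inversion hns (x := (Int.fract r : ℚ)) (by exact_mod_cast h0)
      rw [← Rat.cast_inv, ih _ ?_ (Int.fract r)⁻¹ rfl, add_comm] at hinv
      · exact (ENNReal.add_right_inj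
          (ENNReal.mul_ne_top ENNReal.ofReal_ne_top ENNReal.ofReal_ne_top)).1 hinv
      · have hlt := Rat.num_lt_denom_iff.2 (Int.fract_lt_one r)
        have hnn := Rat.num_nonneg.2 (Int.fract_nonneg r)
        rw [Rat.den_intFract] at hlt
        rw [Rat.den_inv_of_ne_zero h0]
        omega

theorem posSum_le {D : ℕ} (hns : ¬ IsSquare D) (x : ℝ) :
    posSum D (fun q => q.1 < 0) x ≤ ENNReal.ofReal (leadSum D) :=
  Rat.denseRange_cast.induction_on x
    ((lowerSemicontinuous_posSum D _).isClosed_preimage _) fun r => (posSum_rat hns r).le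

theorem leadSum_sub_posSum_le {D : ℕ} (hns : ¬ IsSquare D) (n : ℕ) (x : ℝ) :
    leadSum D - (posSum D (fun q => q.1 < 0) x).toReal ≤ leadSum D * (1 / 4) ^ n := by
  have hA := leadSum_nonneg D
  induction n generalizing x with
  | zero => simp
  | succ n ih =>
    obtain ⟨y, hy, hxy⟩ : ∃ y : ℝ, |y| ≤ 1 / 2 ∧ x = y + round x :=
      ⟨x - round x, abs_sub_round x, by ring⟩
    rw [hxy, posSum_add_int]
    rcases eq_or_ne y 0 with rfl | h0
    · rw [posSum_zero hns, ENNReal.toReal_ofReal hA, sub_self]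
      positivity
    · have hfin (z : ℝ) : posSum D (fun q => q.1 < 0) z ≠ ∞ :=
        ne_top_of_le_ne_top ENNReal.ofReal_ne_top (posSum_le hns z)
      have hinv := congrArg ENNReal.toReal (posSum_inversion hns h0)
      rw [ENNReal.toReal_add (hfin _) (by finiteness),
        ENNReal.toReal_add (ENNReal.mul_ne_top (by finiteness) (hfin _)) (by finiteness),
        ENNReal.toReal_mul, ENNReal.toReal_mul, ENNReal.toReal_ofReal (sq_nonneg y),
        ENNReal.toReal_ofReal hA] at hinv
      have hy2 : y ^ 2 ≤ 1 / 4 := by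
        rw [← sq_abs]; nlinarith [abs_nonneg y]
      calc _ = y ^ 2 * (leadSum D - (posSum D (fun q => q.1 < 0) y⁻¹).toReal) := by linarith
        _ ≤ y ^ 2 * (leadSum D * (1 / 4) ^ n) := by gcongr; exact ih _
        _ ≤ 1 / 4 * (leadSum D * (1 / 4) ^ n) := by gcongr
        _ = _ := by ring

theorem posSum_eq_leadSum {D : ℕ} (hns : ¬ IsSquare D) (x : ℝ) :
    posSum D (fun q => q.1 < 0) x = ENNReal.ofReal (leadSum D) := by
  refine (posSum_le hns x).antisymm (ENNReal.ofReal_le_of_le_toReal (sub_nonpos.1 ?_))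
  refine ge_of_tendsto' (x := Filter.atTop) ?_ fun n => leadSum_sub_posSum_le hns n x
  simpa using (tendsto_pow_atTop_nhds_zero_of_lt_one (r := (1 / 4 : ℝ)) (by norm_num)
    (by norm_num)).const_mul (leadSum D)

theorem tsum_QDx_ofReal (D : ℕ) (x : ℝ) :
    ∑' q : QDx D x, ENNReal.ofReal (Qval q.1 x) = posSum D (fun q => q.1 < 0) x := by
  classical
  rw [tsum_subtype (QDx D x) fun q => ENNReal.ofReal (Qval q x)]
  refine tsum_congr fun q => ?_
  simp only [QDx, Set.indicator_apply, Set.mem_ofPred_eq, ← and_assoc]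
  by_cases h : 0 < Qval q x
  · simp [h]
  · simp [h, ENNReal.ofReal_of_nonpos (not_lt.1 h)]

/-- For a positive non-square discriminant `D`, the set of simple forms
`{(a,b,c) : b² - 4ac = D, a > 0 > c}` is finite, and for every real `x`,
`∑_{Q ∈ 𝒬_D⟨x⟩} Q(x) = ∑_{(a,b,c) simple of disc D} a`. -/
theorem stmt1 (D : ℕ) (hD : 0 < D) (hns : ¬ IsSquare D)
    (hmod : D % 4 = 0 ∨ D % 4 = 1) :
    (SimpleD D).Finite ∧
    ∀ x : ℝ,
      Summable (fun q : ↥(QDx D x) => Qval q.1 x) ∧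
      (∑' q : ↥(QDx D x), Qval q.1 x) = ∑' q : ↥(SimpleD D), (q.1.1 : ℝ) := by
  refine ⟨SimpleD_finite D, fun x => ?_⟩
  have hsum := (tsum_QDx_ofReal D x).trans (posSum_eq_leadSum hns x)
  have hpos (q : QDx D x) : (ENNReal.ofReal (Qval q.1 x)).toReal = Qval q.1 x :=
    ENNReal.toReal_ofReal q.2.2.2.le
  constructor
  · simpa only [hpos] using
      ENNReal.summable_toReal (hsum.trans_ne ENNReal.ofReal_ne_top)
  · have h := congrArg ENNReal.toReal hsum
    rw [ENNReal.tsum_toReal_eq fun _ => ENNReal.ofReal_ne_top,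
      ENNReal.toReal_ofReal (leadSum_nonneg D)] at h
    simp only [hpos] at h
    have := (SimpleD_finite D).fintype
    rw [h, tsum_fintype, leadSum, ← Finset.sum_coe_sort]
    exact Fintype.sum_equiv (Equiv.subtypeEquivRight fun q => by simp) _ _ fun _ => rfl
end
end

section
/- Let d be a positive even integer, A a Γ-equivalence class in F_d (Γ = PGL₂(ℤ) acting by P ↦ P|γ), and x an irrational real number. Then the map (P, γ) ↦ P|γ is a bijection from the set {(P, γ) ∈ A^Sim × Γ(x) : P(γ(∞)) < 0 < P(⌊γ(x)⌋)} onto A⟨x⟩. -/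
open Polynomial Matrix

noncomputable section

/-- The homogenization of `P` of degree `d`, evaluated at real arguments. -/
def homEvalReal (d : ℕ) (P : Polynomial ℤ) (r t : ℝ) : ℝ :=
  ∑ j ∈ Finset.range (d + 1), (P.coeff j : ℝ) * r ^ j * t ^ (d - j)

lemma homEval_cast (d : ℕ) (P : Polynomial ℤ) (r t : ℤ) :
    ((homEval d P r t : ℤ) : ℝ) = homEvalReal d P r t := by
  simp [homEval, homEvalReal]

lemma aeval_eq_homEvalReal {d : ℕ} {P : Polynomial ℤ} (hP : P.natDegree ≤ d) (y : ℝ) :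
    Polynomial.aeval y P = homEvalReal d P y 1 := by
  rw [Polynomial.aeval_eq_sum_range' (Nat.lt_succ_of_le hP)]
  simp [homEvalReal]

lemma homEvalReal_of_ne_zero {d : ℕ} {P : Polynomial ℤ} (hP : P.natDegree ≤ d) (r : ℝ) {t : ℝ}
    (ht : t ≠ 0) : homEvalReal d P r t = t ^ d * Polynomial.aeval (r / t) P := by
  rw [aeval_eq_homEvalReal hP, homEvalReal, homEvalReal, Finset.mul_sum]
  refine Finset.sum_congr rfl fun j hj => ?_
  have hj : j ≤ d := Nat.lt_succ_iff.mp (Finset.mem_range.mp hj)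
  have h : t ^ d = t ^ j * t ^ (d - j) := by rw [← pow_add, Nat.add_sub_cancel' hj]
  rw [h, div_pow]
  field_simp
  simp

lemma homEvalReal_zero_right (d : ℕ) (P : Polynomial ℤ) (r : ℝ) :
    homEvalReal d P r 0 = P.coeff d * r ^ d := by
  rw [homEvalReal, Finset.sum_range_succ, Finset.sum_eq_zero]
  · simp
  · intro j hj
    have : d - j ≠ 0 := by have := Finset.mem_range.mp hj; omega
    simp [this]

lemma homEvalReal_zero_one (d : ℕ) (P : Polynomial ℤ) :
    homEvalReal d P 0 1 = P.coeff 0 := by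
  rw [homEvalReal, Finset.sum_range_succ', Finset.sum_eq_zero]
  · simp
  · intro j _
    simp

lemma natDegree_pslash_le (d : ℕ) (M : Mat2) (P : Polynomial ℤ) :
    (pslash d M P).natDegree ≤ d := by
  refine Polynomial.natDegree_sum_le_of_forall_le _ _ fun j hj => ?_
  have hj : j ≤ d := Nat.lt_succ_iff.mp (Finset.mem_range.mp hj)
  have h₁ : ((C (M 0 0) * X + C (M 0 1)) ^ j : Polynomial ℤ).natDegree ≤ j * 1 :=
    Polynomial.natDegree_pow_le_of_le j Polynomial.natDegree_linear_le
  have h₂ : ((C (M 1 0) * X + C (M 1 1)) ^ (d - j) : Polynomial ℤ).natDegree ≤ (d - j) * 1 :=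
    Polynomial.natDegree_pow_le_of_le (d - j) Polynomial.natDegree_linear_le
  have h₃ := Polynomial.natDegree_C_mul_le (P.coeff j)
    ((C (M 0 0) * X + C (M 0 1)) ^ j : Polynomial ℤ)
  refine Polynomial.natDegree_mul_le.trans ?_
  omega

lemma aeval_pslash (d : ℕ) (M : Mat2) (P : Polynomial ℤ) (y : ℝ) :
    Polynomial.aeval y (pslash d M P) =
      homEvalReal d P (M 0 0 * y + M 0 1) (M 1 0 * y + M 1 1) := by
  simp [pslash, homEvalReal]

lemma continuous_homEvalReal {d : ℕ} {P : Polynomial ℤ} {f g : ℝ → ℝ} (hf : Continuous f)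
    (hg : Continuous g) : Continuous fun t => homEvalReal d P (f t) (g t) := by
  unfold homEvalReal
  fun_prop

lemma homEvalReal_pslash (d : ℕ) (M : Mat2) (P : Polynomial ℤ) (r t : ℝ) :
    homEvalReal d (pslash d M P) r t =
      homEvalReal d P (M 0 0 * r + M 0 1 * t) (M 1 0 * r + M 1 1 * t) := by
  have h := Continuous.ext_on (dense_compl_singleton (0 : ℝ))
    (continuous_homEvalReal (d := d) (P := pslash d M P) (f := fun _ => r) (g := fun t => t)
      continuous_const continuous_id)
    (continuous_homEvalReal (d := d) (P := P) (f := fun t => M 0 0 * r + M 0 1 * t)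
      (g := fun t => M 1 0 * r + M 1 1 * t) (by fun_prop) (by fun_prop)) fun t ht => by
      have ht : t ≠ 0 := ht
      rw [homEvalReal_of_ne_zero (natDegree_pslash_le d M P) r ht, aeval_pslash, homEvalReal,
        homEvalReal, Finset.mul_sum]
      refine Finset.sum_congr rfl fun j hj => ?_
      have hj : j ≤ d := Nat.lt_succ_iff.mp (Finset.mem_range.mp hj)
      have h : t ^ d = t ^ j * t ^ (d - j) := by rw [← pow_add, Nat.add_sub_cancel' hj]
      have h₁ : (M 0 0 : ℝ) * r + M 0 1 * t = t * (M 0 0 * (r / t) + M 0 1) := by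
        field_simp
      have h₂ : (M 1 0 : ℝ) * r + M 1 1 * t = t * (M 1 0 * (r / t) + M 1 1) := by
        field_simp
      rw [h₁, h₂, h, mul_pow, mul_pow]
      ring
  exact congrFun h t

lemma eq_of_forall_aeval_eq {P Q : Polynomial ℤ}
    (h : ∀ y : ℝ, Polynomial.aeval y P = Polynomial.aeval y Q) : P = Q := by
  refine Polynomial.map_injective (Int.castRingHom ℝ) Int.cast_injective
    (Polynomial.funext fun y => ?_)
  simpa [Polynomial.aeval_def, Polynomial.eval_map] using h y

lemma pslash_pslash (d : ℕ) (M N : Mat2) (P : Polynomial ℤ) :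
    pslash d N (pslash d M P) = pslash d (M * N) P := by
  refine eq_of_forall_aeval_eq fun y => ?_
  rw [aeval_pslash, homEvalReal_pslash, aeval_pslash]
  simp only [Matrix.mul_apply, Fin.sum_univ_two]
  push_cast
  congr 1 <;> ring

lemma pslash_one {d : ℕ} {P : Polynomial ℤ} (hP : P.natDegree ≤ d) : pslash d 1 P = P := by
  refine eq_of_forall_aeval_eq fun y => ?_
  rw [aeval_pslash, aeval_eq_homEvalReal hP]
  simp

lemma coeff_pslash (d : ℕ) (M : Mat2) (P : Polynomial ℤ) :
    (pslash d M P).coeff d = homEval d P (M 0 0) (M 1 0) := by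
  have h := homEvalReal_zero_right d (pslash d M P) 1
  rw [homEvalReal_pslash] at h
  simp only [mul_one, mul_zero, add_zero, one_pow] at h
  rw [← homEval_cast] at h
  exact_mod_cast h.symm

lemma exists_moebius_preimage {a b c e : ℤ} (h : IsUnit (a * e - b * c)) {w : ℝ}
    (hw : Irrational w) : ∃ v : ℝ, Irrational v ∧
      ∀ y : ℝ, (c * y + e ≠ 0 ∧ (a * y + b) / (c * y + e) = w) ↔ y = v := by
  have hD : ((a : ℝ) * e - b * c) ≠ 0 := by exact_mod_cast h.ne_zero
  have hac : (a : ℝ) - c * w ≠ 0 := by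
    intro h0
    rcases eq_or_ne c 0 with rfl | hc
    · have : (a : ℝ) = 0 := by simpa using h0
      apply hD
      rw [this]
      simp
    · apply hw
      refine ⟨a / c, ?_⟩
      have : (c : ℝ) ≠ 0 := by exact_mod_cast hc
      push_cast
      field_simp
      linarith
  have key : ∀ y : ℝ, (c * y + e ≠ 0 ∧ (a * y + b) / (c * y + e) = w) ↔
      y = (e * w - b) / (a - c * w) := by
    intro y
    rw [eq_div_iff hac]
    constructor
    · rintro ⟨h1, h2⟩
      rw [div_eq_iff h1] at h2
      linarith
    · intro hy
      have h1 : (c : ℝ) * y + e ≠ 0 := by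
        intro h0
        apply hD
        linear_combination ((a : ℝ) - c * w) * h0 - (c : ℝ) * hy
      exact ⟨h1, by rw [div_eq_iff h1]; linarith⟩
  refine ⟨_, ?_, key⟩
  rintro ⟨q, hq⟩
  obtain ⟨-, h2⟩ := (key q).2 hq
  exact hw ⟨(a * q + b) / (c * q + e), by push_cast; exact h2⟩

lemma pslash_mem_Fd {d : ℕ} {P : Polynomial ℤ} (hP : P ∈ Fd d) (h0 : P.coeff d ≠ 0) {M : Mat2}
    (hM : IsUnit M.det) : pslash d M P ∈ Fd d := by
  obtain ⟨hdeg, w, w', hne, hw, hw', hroots⟩ := hP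
  rw [Matrix.det_fin_two] at hM
  have hD : ((M 0 0 : ℝ) * M 1 1 - M 0 1 * M 1 0) ≠ 0 := by exact_mod_cast hM.ne_zero
  obtain ⟨v, hv, hvw⟩ := exists_moebius_preimage hM hw
  obtain ⟨v', hv', hvw'⟩ := exists_moebius_preimage hM hw'
  refine ⟨natDegree_pslash_le d M P, v, v', ?_, hv, hv', fun y => ?_⟩
  · rintro rfl
    exact hne (((hvw v).2 rfl).2.symm.trans ((hvw' v).2 rfl).2)
  rw [aeval_pslash, ← hvw, ← hvw']
  by_cases ht : (M 1 0 : ℝ) * y + M 1 1 = 0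
  · have hr : (M 0 0 : ℝ) * y + M 0 1 ≠ 0 := by
      intro hr
      apply hD
      linear_combination (M 0 0 : ℝ) * ht - (M 1 0 : ℝ) * hr
    rw [ht, homEvalReal_zero_right]
    simp [h0, hr]
  · rw [homEvalReal_of_ne_zero hdeg _ ht]
    simp [ht, hroots]

lemma homEvalReal_intCast_ne_zero {d : ℕ} {Q : Polynomial ℤ} (hQ : Q ∈ Fd d)
    (h0 : Q.coeff d ≠ 0) {r t : ℤ} (hrt : r ≠ 0 ∨ t ≠ 0) : homEvalReal d Q r t ≠ 0 := by
  obtain ⟨hdeg, w, w', -, hw, hw', hroots⟩ := hQ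
  by_cases ht : t = 0
  · subst ht
    have : r ≠ 0 := by tauto
    simp [homEvalReal_zero_right, h0, this]
  · have ht' : (t : ℝ) ≠ 0 := by exact_mod_cast ht
    rw [homEvalReal_of_ne_zero hdeg _ ht']
    refine mul_ne_zero (pow_ne_zero _ ht') fun h => ?_
    rcases (hroots _).1 h with h | h
    · exact hw ⟨r / t, by push_cast; exact h⟩
    · exact hw' ⟨r / t, by push_cast; exact h⟩

lemma exists_aeval_neg {d : ℕ} (hde : Even d) {Q : Polynomial ℤ} (hdeg : Q.natDegree ≤ d)
    (h0 : Q.coeff d < 0) (y : ℝ) :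
    (∃ u < y, Polynomial.aeval u Q < 0) ∧ ∃ u > y, Polynomial.aeval u Q < 0 := by
  have hcont := continuous_homEvalReal (d := d) (P := Q) (f := fun _ => (1 : ℝ)) (g := fun t => t)
    continuous_const continuous_id
  have hneg : homEvalReal d Q 1 0 < 0 := by
    rw [homEvalReal_zero_right]
    simpa using h0
  obtain ⟨δ, hδ, hball⟩ := Metric.isOpen_iff.1 (isOpen_lt hcont continuous_const) 0 hneg
  set s := min (δ / 2) (1 / (|y| + 1)) with hs
  have hpos : 0 < |y| + 1 := by positivity
  have hs0 : 0 < s := lt_min (by positivity) (by positivity)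
  have hsδ : s < δ := (min_le_left _ _).trans_lt (by linarith)
  have hsy : |y| < 1 / s := by
    rw [lt_div_iff₀ hs0]
    have : s * (|y| + 1) ≤ 1 := by
      rw [← le_div_iff₀ hpos]
      exact min_le_right _ _
    nlinarith
  have key : ∀ t : ℝ, t ≠ 0 → |t| < δ → Polynomial.aeval (1 / t) Q < 0 := by
    intro t ht htδ
    have h : homEvalReal d Q 1 t < 0 := hball (by simpa using htδ)
    rw [homEvalReal_of_ne_zero hdeg _ ht] at h
    exact (pos_iff_neg_of_mul_neg h).1 (hde.pow_pos ht)
  refine ⟨⟨1 / (-s), ?_, key _ (by linarith) (by rwa [abs_neg, abs_of_pos hs0])⟩,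
    ⟨1 / s, (le_abs_self y).trans_lt hsy, key _ hs0.ne' (by rwa [abs_of_pos hs0])⟩⟩
  rw [one_div_neg_eq_neg_one_div]
  linarith [neg_abs_le y]

lemma aeval_pos_of_between {d : ℕ} (hde : Even d) {Q : Polynomial ℤ} (hQ : Q ∈ Fd d)
    (h0 : Q.coeff d < 0) {a b c : ℝ} (hab : a ≤ b) (hbc : b ≤ c)
    (ha : 0 < Polynomial.aeval a Q) (hc : 0 < Polynomial.aeval c Q) :
    0 < Polynomial.aeval b Q := by
  obtain ⟨hdeg, w, w', hne, hw, hw', hroots⟩ := hQ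
  by_contra! hb
  have hcont : Continuous fun y : ℝ => Polynomial.aeval y Q := Polynomial.continuous_aeval Q
  obtain ⟨l, hl, hl'⟩ := (exists_aeval_neg hde hdeg h0 a).1
  obtain ⟨u, hu, hu'⟩ := (exists_aeval_neg hde hdeg h0 c).2
  obtain ⟨y₁, ⟨-, h₁⟩, e₁⟩ := intermediate_value_Icc hl.le hcont.continuousOn ⟨hl'.le, ha.le⟩
  obtain ⟨y₂, ⟨h₂, h₂'⟩, e₂⟩ := intermediate_value_Icc' hab hcont.continuousOn ⟨hb, ha.le⟩
  obtain ⟨y₃, ⟨h₃, -⟩, e₃⟩ := intermediate_value_Icc' hu.le hcont.continuousOn ⟨hu'.le, hc.le⟩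
  simp only at e₁ e₂ e₃
  have n₁ : y₁ ≠ a := by rintro rfl; exact ha.ne' e₁
  have n₂ : y₂ ≠ a := by rintro rfl; exact ha.ne' e₂
  have n₂' : y₂ ≠ c := by rintro rfl; exact hc.ne' e₂
  have n₃ : y₃ ≠ c := by rintro rfl; exact hc.ne' e₃
  have l₁ : y₁ < y₂ := (lt_of_le_of_ne h₁ n₁).trans (lt_of_le_of_ne h₂ n₂.symm)
  have l₂ : y₂ < y₃ :=
    (lt_of_le_of_ne (h₂'.trans hbc) n₂').trans (lt_of_le_of_ne h₃ n₃.symm)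
  rcases (hroots _).1 e₁ with r₁ | r₁ <;> rcases (hroots _).1 e₂ with r₂ | r₂ <;>
    rcases (hroots _).1 e₃ with r₃ | r₃ <;> linarith

lemma homEvalReal_pos_iff {d : ℕ} (hde : Even d) {Q : Polynomial ℤ} (hdeg : Q.natDegree ≤ d)
    (r : ℝ) {t : ℝ} (ht : t ≠ 0) :
    0 < homEvalReal d Q r t ↔ 0 < Polynomial.aeval (r / t) Q := by
  rw [homEvalReal_of_ne_zero hdeg _ ht]
  exact mul_pos_iff_of_pos_left (hde.pow_pos ht)

/-! ### Continued fractions -/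

lemma irrational_cfX {x : ℝ} (hx : Irrational x) (i : ℕ) : Irrational (cfX x i) := by
  induction i with
  | zero => exact hx
  | succ i ih =>
    rw [cfX, one_div]
    exact (ih.sub_intCast _).inv

lemma one_lt_cfX_succ {x : ℝ} (hx : Irrational x) (i : ℕ) : 1 < cfX x (i + 1) := by
  rw [cfX]
  have h0 : 0 < cfX x i - ⌊cfX x i⌋ :=
    lt_of_le_of_ne (Int.fract_nonneg _) ((irrational_cfX hx i).sub_intCast _).ne_zero.symm
  rw [lt_div_iff₀ h0, one_mul]
  exact Int.fract_lt_one _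

lemma one_le_cfN_succ {x : ℝ} (hx : Irrational x) (i : ℕ) : 1 ≤ cfN x (i + 1) :=
  Int.le_floor.2 (by simpa using (one_lt_cfX_succ hx i).le)

lemma sub_cfN_mul_cfX_succ {x : ℝ} (hx : Irrational x) (i : ℕ) :
    (cfX x i - cfN x i) * cfX x (i + 1) = 1 := by
  rw [cfX, cfN]
  exact mul_one_div_cancel ((irrational_cfX hx i).sub_intCast _).ne_zero

lemma one_le_qconv {x : ℝ} (hx : Irrational x) (i : ℕ) :
    1 ≤ qconv x (i + 2) ∧ 1 ≤ qconv x (i + 3) := by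
  induction i with
  | zero => simpa [qconv] using one_le_cfN_succ hx 0
  | succ i ih =>
    refine ⟨ih.2, ?_⟩
    have h := one_le_cfN_succ hx (i + 1)
    have e : qconv x (i + 4) = cfN x (i + 2) * qconv x (i + 3) + qconv x (i + 2) := rfl
    change 1 ≤ qconv x (i + 4)
    have : cfN x (i + 1 + 1) = cfN x (i + 2) := rfl
    nlinarith [ih.1, ih.2]

lemma le_qconv {x : ℝ} (hx : Irrational x) (i : ℕ) : (i : ℤ) ≤ qconv x (i + 3) := by
  induction i with
  | zero => simpa using zero_le_one.trans (one_le_qconv hx 0).2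
  | succ i ih =>
    have h : 1 ≤ cfN x (i + 2) := one_le_cfN_succ hx (i + 1)
    have e : qconv x (i + 1 + 3) = cfN x (i + 2) * qconv x (i + 3) + qconv x (i + 2) := rfl
    push_cast
    nlinarith [(one_le_qconv hx i).1, (one_le_qconv hx i).2]

lemma qconv_pos {x : ℝ} (hx : Irrational x) (i : ℕ) : (0 : ℝ) < qconv x (i + 2) := by
  exact_mod_cast (one_le_qconv hx i).1

/-- The error term `q_{i-2} x - p_{i-2}` of the convergents. -/
def convErr (x : ℝ) (i : ℕ) : ℝ := qconv x i * x - pconv x i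

lemma convErr_succ_succ (x : ℝ) (i : ℕ) :
    convErr x (i + 2) = cfN x i * convErr x (i + 1) + convErr x i := by
  simp only [convErr, pconv, qconv]
  push_cast
  ring

lemma convErr_succ_mul_cfX {x : ℝ} (hx : Irrational x) (i : ℕ) :
    convErr x (i + 1) * cfX x i + convErr x i = 0 := by
  induction i with
  | zero => simp [convErr, qconv, pconv, cfX]
  | succ i ih =>
    rw [convErr_succ_succ]
    linear_combination cfX x (i + 1) * ih - convErr x (i + 1) * sub_cfN_mul_cfX_succ hx i

lemma convErr_ne_zero {x : ℝ} (hx : Irrational x) (i : ℕ) : convErr x i ≠ 0 := by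
  induction i with
  | zero => simpa [convErr, qconv, pconv] using hx.ne_zero
  | succ i ih =>
    intro h
    have := convErr_succ_mul_cfX hx i
    rw [h] at this
    exact ih (by linarith)

lemma convErr_mul_neg {x : ℝ} (hx : Irrational x) (i : ℕ) :
    convErr x (i + 1) * convErr x (i + 2) < 0 := by
  have h := convErr_succ_mul_cfX hx (i + 1)
  have h1 := one_lt_cfX_succ hx i
  have h2 : 0 < convErr x (i + 2) ^ 2 := by positivity [convErr_ne_zero hx (i + 2)]
  have h3 : convErr x (i + 1) = -(convErr x (i + 2) * cfX x (i + 1)) := by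
    linear_combination h
  rw [h3]
  nlinarith

lemma abs_convErr_le_one {x : ℝ} (hx : Irrational x) (i : ℕ) : |convErr x (i + 1)| ≤ 1 := by
  induction i with
  | zero => simp [convErr, qconv, pconv]
  | succ i ih =>
    have h := convErr_succ_mul_cfX hx (i + 1)
    have h1 := one_lt_cfX_succ hx i
    have h3 : convErr x (i + 1) = -(convErr x (i + 2) * cfX x (i + 1)) := by
      linear_combination h
    rw [h3, abs_neg, abs_mul, abs_of_pos (zero_lt_one.trans h1)] at ih
    change |convErr x (i + 2)| ≤ 1
    nlinarith [abs_nonneg (convErr x (i + 2))]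

/-- The inverse of `gam x i`, whose columns are consecutive convergents. -/
def convMat (x : ℝ) (i : ℕ) : Mat2 :=
  !![pconv x (i + 1), pconv x i; qconv x (i + 1), qconv x i]

lemma convMat_mul_gam (x : ℝ) (i : ℕ) : convMat x i * gam x i = 1 := by
  induction i with
  | zero => simp [convMat, gam, pconv, qconv, Matrix.one_fin_two]
  | succ i ih =>
    have h : convMat x (i + 1) * (Meps * Tpow (-(cfN x i))) = convMat x i := by
      simp [convMat, Meps, Tpow, pconv, qconv, mul_comm]
    rw [gam, ← Matrix.mul_assoc, h, ih]

lemma gam_mul_convMat (x : ℝ) (i : ℕ) : gam x i * convMat x i = 1 :=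
  mul_eq_one_comm.1 (convMat_mul_gam x i)

lemma isUnit_det_gam (x : ℝ) (i : ℕ) : IsUnit (gam x i).det :=
  Matrix.isUnit_det_of_left_inverse (convMat_mul_gam x i)

lemma isUnit_det_convMat (x : ℝ) (i : ℕ) : IsUnit (convMat x i).det :=
  Matrix.isUnit_det_of_left_inverse (gam_mul_convMat x i)

lemma moeb_gam {x : ℝ} (hx : Irrational x) (i : ℕ) : moeb (gam x i) x = cfX x i := by
  suffices h : (gam x i 1 0 : ℝ) * x + gam x i 1 1 ≠ 0 ∧ moeb (gam x i) x = cfX x i from h.2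
  induction i with
  | zero => simp [gam, moeb, cfX]
  | succ i ih =>
    obtain ⟨hD, hX⟩ := ih
    rw [moeb, div_eq_iff hD] at hX
    have hfr : cfX x i - cfN x i ≠ 0 := ((irrational_cfX hx i).sub_intCast _).ne_zero
    have e00 : gam x (i + 1) 0 0 = gam x i 1 0 := by
      simp [gam, Meps, Tpow, Matrix.mul_apply, Fin.sum_univ_two]
    have e01 : gam x (i + 1) 0 1 = gam x i 1 1 := by
      simp [gam, Meps, Tpow, Matrix.mul_apply, Fin.sum_univ_two]
    have e10 : gam x (i + 1) 1 0 = gam x i 0 0 - cfN x i * gam x i 1 0 := by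
      simp [gam, Meps, Tpow, Matrix.mul_apply, Fin.sum_univ_two]
      ring
    have e11 : gam x (i + 1) 1 1 = gam x i 0 1 - cfN x i * gam x i 1 1 := by
      simp [gam, Meps, Tpow, Matrix.mul_apply, Fin.sum_univ_two]
      ring
    have hden : (gam x (i + 1) 1 0 : ℝ) * x + gam x (i + 1) 1 1 =
        (cfX x i - cfN x i) * ((gam x i 1 0 : ℝ) * x + gam x i 1 1) := by
      rw [e10, e11]
      push_cast
      linear_combination hX
    refine ⟨by rw [hden]; exact mul_ne_zero hfr hD, ?_⟩
    rw [moeb, hden, e00, e01, cfX]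
    change _ = 1 / (cfX x i - cfN x i)
    field_simp

/-! ### Signs along the convergents -/

/-- The homogenized value of `Q` at the convergent with index `i - 2`. -/
def convVal (d : ℕ) (Q : Polynomial ℤ) (x : ℝ) (i : ℕ) : ℝ :=
  homEvalReal d Q (pconv x i) (qconv x i)

lemma convVal_one (d : ℕ) (Q : Polynomial ℤ) (x : ℝ) : convVal d Q x 1 = Q.coeff d := by
  simp [convVal, pconv, qconv, homEvalReal_zero_right]

lemma convVal_ne_zero {d : ℕ} {Q : Polynomial ℤ} (hQ : Q ∈ Fd d) (h0 : Q.coeff d ≠ 0) {x : ℝ}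
    (hx : Irrational x) (i : ℕ) : convVal d Q x (i + 1) ≠ 0 := by
  cases i with
  | zero => rw [convVal_one]; exact_mod_cast h0
  | succ i =>
    refine homEvalReal_intCast_ne_zero hQ h0 (Or.inr ?_)
    exact (zero_lt_one.trans_le (one_le_qconv hx i).1).ne'

lemma convVal_pos_iff {d : ℕ} (hde : Even d) {Q : Polynomial ℤ} (hdeg : Q.natDegree ≤ d) {x : ℝ}
    (hx : Irrational x) (i : ℕ) : 0 < convVal d Q x (i + 2) ↔
      0 < Polynomial.aeval ((pconv x (i + 2) : ℝ) / qconv x (i + 2)) Q :=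
  homEvalReal_pos_iff hde hdeg _ (qconv_pos hx i).ne'

lemma aeval_pos_of_convVal_pos {d : ℕ} (hde : Even d) {Q : Polynomial ℤ} (hQ : Q ∈ Fd d)
    (h0 : Q.coeff d < 0) {x : ℝ} (hx : Irrational x) {i : ℕ} (h₁ : 0 < convVal d Q x (i + 2))
    (h₂ : 0 < convVal d Q x (i + 3)) : 0 < Polynomial.aeval x Q := by
  rw [convVal_pos_iff hde hQ.1 hx] at h₁ h₂
  have q₁ := qconv_pos hx i
  have q₂ := qconv_pos hx (i + 1)
  have hE : convErr x (i + 2) * convErr x (i + 3) < 0 := convErr_mul_neg hx (i + 1)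
  simp only [convErr] at hE
  rcases mul_neg_iff.1 hE with ⟨a, b⟩ | ⟨a, b⟩
  · refine aeval_pos_of_between hde hQ h0 ?_ ?_ h₁ h₂
    · rw [div_le_iff₀ q₁]; linarith
    · rw [le_div_iff₀ q₂]; linarith
  · refine aeval_pos_of_between hde hQ h0 ?_ ?_ h₂ h₁
    · rw [div_le_iff₀ q₂]; linarith
    · rw [le_div_iff₀ q₁]; linarith

lemma convVal_pos_step {d : ℕ} (hde : Even d) {Q : Polynomial ℤ} (hQ : Q ∈ Fd d)
    (h0 : Q.coeff d < 0) {x : ℝ} (hx : Irrational x) {i : ℕ} (h₁ : 0 < convVal d Q x (i + 2))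
    (h₂ : 0 < convVal d Q x (i + 3)) : 0 < convVal d Q x (i + 4) := by
  rw [convVal_pos_iff hde hQ.1 hx] at h₁ h₂ ⊢
  have q₁ := qconv_pos hx i
  have q₂ : (0 : ℝ) < qconv x (i + 3) := qconv_pos hx (i + 1)
  have q₃ := qconv_pos hx (i + 2)
  have hn : (1 : ℝ) ≤ cfN x (i + 2) := by exact_mod_cast one_le_cfN_succ hx (i + 1)
  have hn0 : (0 : ℝ) < cfN x (i + 2) := by linarith
  have ep : (pconv x (i + 2 + 2) : ℝ) = cfN x (i + 2) * pconv x (i + 3) + pconv x (i + 2) := by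
    simp [pconv]
  have eq : (qconv x (i + 2 + 2) : ℝ) = cfN x (i + 2) * qconv x (i + 3) + qconv x (i + 2) := by
    simp [qconv]
  set p := (pconv x (i + 2) : ℝ)
  set q := (qconv x (i + 2) : ℝ)
  set p' := (pconv x (i + 3) : ℝ)
  set q' := (qconv x (i + 3) : ℝ)
  rw [ep, eq]
  rw [eq] at q₃
  rcases le_total (p * q') (p' * q) with h | h
  · refine aeval_pos_of_between hde hQ h0 ?_ ?_ h₁ h₂
    · rw [div_le_div_iff₀ q₁ q₃]; nlinarith
    · rw [div_le_div_iff₀ q₃ q₂]; nlinarith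
  · refine aeval_pos_of_between hde hQ h0 ?_ ?_ h₂ h₁
    · rw [div_le_div_iff₀ q₂ q₃]; nlinarith
    · rw [div_le_div_iff₀ q₃ q₁]; nlinarith

lemma convVal_pos_of_le {d : ℕ} (hde : Even d) {Q : Polynomial ℤ} (hQ : Q ∈ Fd d)
    (h0 : Q.coeff d < 0) {x : ℝ} (hx : Irrational x) {i : ℕ} (h₁ : 0 < convVal d Q x (i + 2))
    (h₂ : 0 < convVal d Q x (i + 3)) (k : ℕ) : 0 < convVal d Q x (i + k + 2) := by
  suffices h : 0 < convVal d Q x (i + k + 2) ∧ 0 < convVal d Q x (i + k + 3) from h.1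
  induction k with
  | zero => exact ⟨h₁, h₂⟩
  | succ k ih => exact ⟨ih.2, convVal_pos_step hde hQ h0 hx ih.1 ih.2⟩

lemma eventually_convVal_pos {d : ℕ} (hde : Even d) {Q : Polynomial ℤ} (hdeg : Q.natDegree ≤ d)
    {x : ℝ} (hx : Irrational x) (hpos : 0 < Polynomial.aeval x Q) :
    ∃ N, ∀ k, N ≤ k → 0 < convVal d Q x (k + 1) := by
  have hcont : Continuous fun y : ℝ => Polynomial.aeval y Q := Polynomial.continuous_aeval Q
  obtain ⟨δ, hδ, hball⟩ := Metric.isOpen_iff.1 (isOpen_lt continuous_const hcont) x hpos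
  obtain ⟨m, hm⟩ := exists_nat_gt (1 / δ)
  refine ⟨m + 2, fun k hk => ?_⟩
  obtain ⟨j, rfl⟩ := Nat.exists_eq_add_of_le hk
  have hidx : m + 2 + j + 1 = m + j + 1 + 2 := by omega
  rw [hidx, convVal_pos_iff hde hdeg hx]
  refine hball ?_
  have hq := qconv_pos hx (m + j + 1)
  have hle : ((m + j : ℕ) : ℝ) ≤ qconv x (m + j + 1 + 2) := by exact_mod_cast le_qconv hx (m + j)
  have hE := abs_convErr_le_one hx (m + j + 1 + 1)
  rw [convErr, show m + j + 1 + 1 + 1 = m + j + 1 + 2 from rfl] at hE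
  rw [Metric.mem_ball, dist_comm, Real.dist_eq]
  have e : x - (pconv x (m + j + 1 + 2) : ℝ) / qconv x (m + j + 1 + 2) =
      (qconv x (m + j + 1 + 2) * x - pconv x (m + j + 1 + 2)) / qconv x (m + j + 1 + 2) := by
    field_simp
  rw [e, abs_div, abs_of_pos hq, div_lt_iff₀ hq]
  rw [div_lt_iff₀ hδ] at hm
  push_cast at hle
  have : (0 : ℝ) ≤ j := by positivity
  nlinarith

lemma mem_class_of_pslash {d : ℕ} {A : Set (Polynomial ℤ)} (hA : IsClassF d A)
    {P : Polynomial ℤ} (hP : P ∈ A) (h0 : P.coeff d ≠ 0) {M : Mat2} (hM : IsUnit M.det) :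
    pslash d M P ∈ A := by
  obtain ⟨P₀, -, rfl⟩ := hA
  obtain ⟨hF, N, hN, rfl⟩ := hP
  exact ⟨pslash_mem_Fd hF h0 hM, N * M, by rw [Matrix.det_mul]; exact hN.mul hM,
    pslash_pslash d N M P₀⟩

lemma mem_Fd_of_mem_class {d : ℕ} {A : Set (Polynomial ℤ)} (hA : IsClassF d A)
    {P : Polynomial ℤ} (hP : P ∈ A) : P ∈ Fd d := by
  obtain ⟨P₀, -, rfl⟩ := hA
  exact hP.1

lemma convVal_eq_coeff_top (d : ℕ) (Q : Polynomial ℤ) (x : ℝ) (i : ℕ) :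
    convVal d Q x (i + 1) = (pslash d (convMat x i) Q).coeff d := by
  rw [coeff_pslash, homEval_cast]
  rfl

lemma convVal_eq_coeff_zero (d : ℕ) (Q : Polynomial ℤ) (x : ℝ) (i : ℕ) :
    convVal d Q x i = (pslash d (convMat x i) Q).coeff 0 := by
  rw [← homEvalReal_zero_one d, homEvalReal_pslash]
  simp [convMat, convVal]

lemma convVal_eq_aeval (d : ℕ) (Q : Polynomial ℤ) (x : ℝ) (i : ℕ) :
    convVal d Q x (i + 2) =
      ((Polynomial.aeval (cfN x i) (pslash d (convMat x i) Q) : ℤ) : ℝ) := by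
  have h : ((Polynomial.aeval (cfN x i) (pslash d (convMat x i) Q) : ℤ) : ℝ) =
      Polynomial.aeval (cfN x i : ℝ) (pslash d (convMat x i) Q) := by
    simpa using (Polynomial.aeval_algebraMap_apply ℝ (cfN x i) (pslash d (convMat x i) Q)).symm
  rw [h, aeval_pslash]
  simp [convMat, convVal, pconv, qconv, mul_comm]

/-- **Theorem 3 of the paper.** For even `d > 0`, `A` a `Γ`-equivalence
class in `F_d` and `x` irrational, the map `(P,γ) ↦ P|γ` is a bijection from
`{(P,γ) ∈ A^Sim × Γ(x) : P(γ(∞)) < 0 < P(⌊γ(x)⌋)}` onto `A⟨x⟩`. -/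
theorem stmt2 (d : ℕ) (hd : 0 < d) (hde : Even d) (A : Set (Polynomial ℤ))
    (hA : IsClassF d A) (x : ℝ) (hx : Irrational x) :
    Set.BijOn (fun pg : Polynomial ℤ × Mat2 => pslash d pg.2 pg.1)
      {pg : Polynomial ℤ × Mat2 | pg.1 ∈ PSim d A ∧ pg.2 ∈ GammaSet x ∧
        homEval d pg.1 (pg.2 0 0) (pg.2 1 0) < 0 ∧
        0 < Polynomial.aeval (⌊moeb pg.2 x⌋ : ℤ) pg.1}
      (Px d A x) := by
  have hstep : ∀ P : Polynomial ℤ, ∀ i, P.natDegree ≤ d →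
      pslash d (convMat x i) (pslash d (gam x i) P) = P := fun P i hP => by
    rw [pslash_pslash, gam_mul_convMat, pslash_one hP]
  have hstep' : ∀ P : Polynomial ℤ, ∀ i, P.natDegree ≤ d →
      pslash d (gam x i) (pslash d (convMat x i) P) = P := fun P i hP => by
    rw [pslash_pslash, convMat_mul_gam, pslash_one hP]
  have hsigns : ∀ P : Polynomial ℤ, ∀ i, P ∈ PSim d A →
      0 < Polynomial.aeval (⌊moeb (gam x i) x⌋ : ℤ) P →
      convVal d (pslash d (gam x i) P) x i < 0 ∧
      0 < convVal d (pslash d (gam x i) P) x (i + 1) ∧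
      0 < convVal d (pslash d (gam x i) P) x (i + 2) := by
    rintro P i ⟨hPA, hP0, hPd⟩ hfl
    rw [convVal_eq_coeff_zero, convVal_eq_coeff_top, convVal_eq_aeval,
      hstep P i (mem_Fd_of_mem_class hA hPA).1]
    rw [moeb_gam hx] at hfl
    exact ⟨by exact_mod_cast hP0, by exact_mod_cast hPd, by exact_mod_cast hfl⟩
  have hmaps : ∀ P : Polynomial ℤ, ∀ i, 1 ≤ i → P ∈ PSim d A →
      homEval d P (gam x i 0 0) (gam x i 1 0) < 0 →
      0 < Polynomial.aeval (⌊moeb (gam x i) x⌋ : ℤ) P →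
      pslash d (gam x i) P ∈ Px d A x := by
    intro P i hi hP hneg hfl
    have hQA : pslash d (gam x i) P ∈ A :=
      mem_class_of_pslash hA hP.1 hP.2.2.ne' (isUnit_det_gam x i)
    rw [← coeff_pslash] at hneg
    obtain ⟨-, h₁, h₂⟩ := hsigns P i hP hfl
    obtain ⟨k, rfl⟩ := Nat.exists_eq_add_of_le' hi
    exact ⟨hQA, hneg,
      aeval_pos_of_convVal_pos hde (mem_Fd_of_mem_class hA hQA) hneg hx h₁ h₂⟩
  have hunique : ∀ Q ∈ Px d A x, ∀ i j, 1 ≤ i → i < j → 0 < convVal d Q x (i + 1) →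
      0 < convVal d Q x (i + 2) → ¬ convVal d Q x j < 0 := by
    rintro Q ⟨hQA, hneg, -⟩ i j hi hij h₁ h₂
    obtain ⟨i, rfl⟩ := Nat.exists_eq_add_of_le' hi
    obtain ⟨k, rfl⟩ := Nat.exists_eq_add_of_lt hij
    have h := convVal_pos_of_le hde (mem_Fd_of_mem_class hA hQA) hneg hx h₁ h₂ k
    rw [show i + 1 + k + 1 = i + k + 2 by omega]
    exact h.le.not_gt
  refine ⟨?_, ?_, ?_⟩
  · rintro ⟨P, M⟩ ⟨hP, ⟨i, hi, rfl⟩, hneg, hfl⟩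
    exact hmaps P i hi hP hneg hfl
  · rintro ⟨P, M⟩ ⟨hP, ⟨i, hi, rfl⟩, hneg, hfl⟩ ⟨P', M'⟩ ⟨hP', ⟨j, hj, rfl⟩, hneg', hfl'⟩ hEq
    simp only at hP hneg hfl hP' hneg' hfl' hEq
    have hQ := hmaps P i hi hP hneg hfl
    obtain ⟨a₁, a₂, a₃⟩ := hsigns P i hP hfl
    obtain ⟨b₁, b₂, b₃⟩ := hsigns P' j hP' hfl'
    rw [← hEq] at b₁ b₂ b₃
    rcases lt_trichotomy i j with hij | rfl | hij
    · exact absurd b₁ (hunique _ hQ i j hi hij a₂ a₃)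
    · have h := congrArg (pslash d (convMat x i)) hEq
      rw [hstep P i (mem_Fd_of_mem_class hA hP.1).1,
        hstep P' i (mem_Fd_of_mem_class hA hP'.1).1] at h
      rw [h]
    · exact absurd a₁ (hunique _ hQ j i hj hij b₂ b₃)
  · rintro Q ⟨hQA, hneg, hpos⟩
    have hQF := mem_Fd_of_mem_class hA hQA
    have hex := eventually_convVal_pos hde hQF.1 hx hpos
    classical
    obtain ⟨hN, hmin⟩ := And.intro (Nat.find_spec hex) (fun m => Nat.find_min hex (m := m))
    generalize Nat.find hex = N at hN hmin
    have hone : convVal d Q x 1 < 0 := by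
      rw [convVal_one]
      exact_mod_cast hneg
    obtain ⟨i, rfl⟩ : ∃ i, N = i + 1 := by
      refine Nat.exists_eq_succ_of_ne_zero ?_
      rintro rfl
      exact hone.not_gt (hN 0 le_rfl)
    have h₁ : convVal d Q x (i + 1) < 0 := by
      refine lt_of_le_of_ne (not_lt.1 fun h => hmin i (Nat.lt_succ_self i) fun k hk => ?_)
        (convVal_ne_zero hQF hneg.ne hx i)
      rcases hk.eq_or_lt with rfl | hk
      · exact h
      · exact hN k hk
    have h₂ : 0 < convVal d Q x (i + 1 + 1) := hN (i + 1) le_rfl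
    have h₃ : 0 < convVal d Q x (i + 1 + 2) := hN (i + 2) (Nat.le_succ _)
    refine ⟨(pslash d (convMat x (i + 1)) Q, gam x (i + 1)),
      ⟨⟨?_, ?_, ?_⟩, ⟨i + 1, Nat.le_add_left _ _, rfl⟩, ?_, ?_⟩, hstep' Q (i + 1) hQF.1⟩
    · exact mem_class_of_pslash hA hQA hneg.ne (isUnit_det_convMat x _)
    · rw [convVal_eq_coeff_zero] at h₁
      exact_mod_cast h₁
    · rw [convVal_eq_coeff_top] at h₂
      exact_mod_cast h₂
    · rw [← coeff_pslash, hstep' Q (i + 1) hQF.1]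
      exact hneg
    · rw [convVal_eq_aeval] at h₃
      simp only [moeb_gam hx]
      exact_mod_cast h₃
end
end
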